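/- If G is a minimal counterexample, then G has no cut-edge; that is, deleting any single edge of G does not increase the number of connected components. -/

import Mathlib

open SimpleGraph

/-- A `(1,2^k)`-packing edge-coloring encoded as a function assigning a color in
`Fin (k+1)` to each unordered pair. Color `0` is the 1-color (its class must be a
matching) and each color `i ≠ 0` is a 2-color (its class must be an induced matching). -/
def IsPackingEC {V : Type} (G : SimpleGraph V) (k : ℕ)
    (c : Sym2 V → Fin (k + 1)) : Prop :=
  (∀ a b x y : V, G.Adj a b → G.Adj x y → s(a, b) ≠ s(x, y) →
      c s(a, b) = 0 → c s(x, y) = 0 →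
      a ≠ x ∧ a ≠ y ∧ b ≠ x ∧ b ≠ y) ∧
  ∀ a b x y : V, G.Adj a b → G.Adj x y → s(a, b) ≠ s(x, y) →
      c s(a, b) = c s(x, y) → c s(a, b) ≠ 0 →
      (a ≠ x ∧ a ≠ y ∧ b ≠ x ∧ b ≠ y) ∧
      ¬G.Adj a x ∧ ¬G.Adj a y ∧ ¬G.Adj b x ∧ ¬G.Adj b y

/-- A good coloring: a `(1,2^7)`-packing edge-coloring in which every edge of the
1-color class (color `0`) has both endpoints of degree 3. -/
def GoodColoring {V : Type} (G : SimpleGraph V) (c : Sym2 V → Fin 8) : Prop :=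
  IsPackingEC G 7 c ∧
  ∀ a b : V, G.Adj a b → c s(a, b) = 0 →
    (G.neighborSet a).ncard = 3 ∧ (G.neighborSet b).ncard = 3

/-- A graph is subcubic if every vertex has degree at most 3. -/
def Subcubic {V : Type} (G : SimpleGraph V) : Prop :=
  ∀ v : V, (G.neighborSet v).ncard ≤ 3

/-- A minimal counterexample: a finite subcubic simple graph with no good coloring such
that every finite subcubic simple graph with smaller `|V| + |E|` has a good coloring. -/
def MinCounter (V : Type) [Finite V] (G : SimpleGraph V) : Prop :=
  Subcubic G ∧
  (¬∃ c : Sym2 V → Fin 8, GoodColoring G c) ∧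
  ∀ (W : Type) [Finite W] (H : SimpleGraph W), Subcubic H →
    Nat.card W + H.edgeSet.ncard < Nat.card V + G.edgeSet.ncard →
    ∃ c : Sym2 W → Fin 8, GoodColoring H c

/-- The subgraph of `G` formed by the edges having at least one endpoint in `A`. -/
def touching {V : Type} (G : SimpleGraph V) (A : Set V) : SimpleGraph V where
  Adj a b := G.Adj a b ∧ (a ∈ A ∨ b ∈ A)
  symm := ⟨fun _ _ h => ⟨h.1.symm, h.2.symm⟩⟩
  loopless := ⟨fun _ h => G.loopless.irrefl _ h.1⟩

lemma touching_le {V : Type} (G : SimpleGraph V) (A : Set V) : touching G A ≤ G :=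
  fun _ _ h => h.1

lemma Subcubic.mono {V : Type} [Finite V] {G H : SimpleGraph V} (hG : Subcubic G) (h : H ≤ G) :
    Subcubic H :=
  fun v => (Set.ncard_le_ncard (fun _ hw => h hw) (Set.toFinite _)).trans (hG v)

lemma ncard_neighborSet_eq_three_of_le {V : Type} [Finite V] {G H : SimpleGraph V}
    (hG : Subcubic G) (h : H ≤ G) {v : V} (hv : (H.neighborSet v).ncard = 3) :
    (G.neighborSet v).ncard = 3 :=
  le_antisymm (hG v) (hv ▸ Set.ncard_le_ncard (fun _ hw => h hw) (Set.toFinite _))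

lemma GoodColoring.perm_comp {V : Type} {G : SimpleGraph V} {c : Sym2 V → Fin 8}
    (hc : GoodColoring G c) (σ : Equiv.Perm (Fin 8)) (h0 : σ 0 = 0) :
    GoodColoring G (σ ∘ c) := by
  have key : ∀ i, σ i = 0 ↔ i = 0 := fun i => by rw [← h0, σ.apply_eq_iff_eq, h0]
  refine ⟨⟨fun a b x y hab hxy hne h1 h2 => ?_, fun a b x y hab hxy hne h1 h2 => ?_⟩,
    fun a b hab h => ?_⟩
  · exact hc.1.1 a b x y hab hxy hne ((key _).1 h1) ((key _).1 h2)
  · exact hc.1.2 a b x y hab hxy hne (σ.injective h1) (fun h => h2 ((key _).2 h))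
  · exact hc.2 a b hab ((key _).1 h)

/-- Good colorings of the two sides of a cut with at most one crossing edge `xy` glue together,
provided that they agree on `xy` and that no nonzero color occurs both on another edge at `x`
and on another edge at `y`. -/
lemma exists_goodColoring_of_touching {V : Type} [Finite V] {G : SimpleGraph V}
    (hG : Subcubic G) {A : Set V} {x y : V} (hx : x ∈ A) (hy : y ∉ A)
    (hcut : ∀ a b, a ∈ A → b ∉ A → G.Adj a b → a = x ∧ b = y)
    {c₁ c₂ : Sym2 V → Fin 8}
    (h₁ : GoodColoring (touching G A) c₁) (h₂ : GoodColoring (touching G Aᶜ) c₂)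
    (hxy : G.Adj x y → c₁ s(x, y) = c₂ s(x, y) ∧
      ∀ a b, G.Adj x a → G.Adj y b → a ≠ y → b ≠ x →
        c₁ s(x, a) = c₂ s(y, b) → c₁ s(x, a) = 0) :
    ∃ c : Sym2 V → Fin 8, GoodColoring G c := by
  classical
  let c : Sym2 V → Fin 8 := fun e => if ∃ a ∈ e, a ∈ A then c₁ e else c₂ e
  have e₁ : ∀ a b, (touching G A).Adj a b → c s(a, b) = c₁ s(a, b) := by
    intro a b h
    have : ∃ w ∈ s(a, b), w ∈ A := by
      rcases h.2 with h | h
      exacts [⟨a, by simp, h⟩, ⟨b, by simp, h⟩]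
    simp only [c, if_pos this]
  have e₂ : ∀ a b, (touching G Aᶜ).Adj a b → c s(a, b) = c₂ s(a, b) := by
    intro a b h
    by_cases ha : a ∈ A
    · have hb : b ∉ A := by simpa [ha] using h.2
      obtain ⟨rfl, rfl⟩ := hcut a b ha hb h.1
      rw [e₁ _ _ ⟨h.1, Or.inl ha⟩, (hxy h.1).1]
    · by_cases hb : b ∈ A
      · obtain ⟨rfl, rfl⟩ := hcut b a hb ha h.1.symm
        rw [e₁ _ _ ⟨h.1, Or.inr hb⟩, Sym2.eq_swap, (hxy h.1.symm).1]
      · simp [c, ha, hb]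
  have side : ∀ a b, G.Adj a b →
      (touching G A).Adj a b ∨ (touching G Aᶜ).Adj a b ∧ a ∉ A ∧ b ∉ A := by
    intro a b h
    by_cases ha : a ∈ A
    · exact Or.inl ⟨h, Or.inl ha⟩
    · by_cases hb : b ∈ A
      · exact Or.inl ⟨h, Or.inr hb⟩
      · exact Or.inr ⟨⟨h, Or.inl ha⟩, ha, hb⟩
  have mixed : ∀ a b u v, G.Adj a b → G.Adj u v → a ∈ A → b ∈ A → u ∉ A → v ∉ A →
      c s(a, b) = c s(u, v) → c s(a, b) ≠ 0 → ¬G.Adj a u := by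
    intro a b u v hab huv ha hb hu hv heq hne hau
    obtain ⟨rfl, rfl⟩ := hcut a u ha hu hau
    rw [e₁ _ _ ⟨hab, Or.inl ha⟩] at heq hne
    rw [e₂ _ _ ⟨huv, Or.inl hu⟩] at heq
    exact hne ((hxy hau).2 b v hab huv (fun h => hu (h ▸ hb)) (fun h => hv (h ▸ ha)) heq)
  -- Pairs of edges lying on the same side of the cut.
  have lift₁ : ∀ a b u v, (touching G A).Adj a b → (touching G A).Adj u v →
      ¬(touching G A).Adj a u → ¬G.Adj a u := by
    intro a b u v hab huv hn hau
    have ha : a ∉ A := fun h => hn ⟨hau, Or.inl h⟩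
    have hu : u ∉ A := fun h => hn ⟨hau, Or.inr h⟩
    have h1 := hcut b a (hab.2.resolve_left ha) ha hab.1.symm
    have h2 := hcut v u (huv.2.resolve_left hu) hu huv.1.symm
    exact hau.ne (h1.2.trans h2.2.symm)
  have inner₁ : ∀ a b u v, (touching G A).Adj a b → (touching G A).Adj u v →
      s(a, b) ≠ s(u, v) → c s(a, b) = c s(u, v) → c s(a, b) ≠ 0 →
      (a ≠ u ∧ a ≠ v ∧ b ≠ u ∧ b ≠ v) ∧
      ¬G.Adj a u ∧ ¬G.Adj a v ∧ ¬G.Adj b u ∧ ¬G.Adj b v := by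
    intro a b u v hab huv hne heq h0
    rw [e₁ _ _ hab] at heq h0
    rw [e₁ _ _ huv] at heq
    obtain ⟨hd, n1, n2, n3, n4⟩ := h₁.1.2 a b u v hab huv hne heq h0
    exact ⟨hd, lift₁ a b u v hab huv n1, lift₁ a b v u hab huv.symm n2,
      lift₁ b a u v hab.symm huv n3, lift₁ b a v u hab.symm huv.symm n4⟩
  have inner₂ : ∀ a b u v, (touching G Aᶜ).Adj a b → (touching G Aᶜ).Adj u v → a ∉ A → b ∉ A →
      s(a, b) ≠ s(u, v) → c s(a, b) = c s(u, v) → c s(a, b) ≠ 0 →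
      (a ≠ u ∧ a ≠ v ∧ b ≠ u ∧ b ≠ v) ∧
      ¬G.Adj a u ∧ ¬G.Adj a v ∧ ¬G.Adj b u ∧ ¬G.Adj b v := by
    intro a b u v hab huv ha hb hne heq h0
    rw [e₂ _ _ hab] at heq h0
    rw [e₂ _ _ huv] at heq
    obtain ⟨hd, n1, n2, n3, n4⟩ := h₂.1.2 a b u v hab huv hne heq h0
    exact ⟨hd, fun h => n1 ⟨h, Or.inl ha⟩, fun h => n2 ⟨h, Or.inl ha⟩,
      fun h => n3 ⟨h, Or.inl hb⟩, fun h => n4 ⟨h, Or.inl hb⟩⟩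
  have outer : ∀ a b u v, (touching G A).Adj a b → (touching G Aᶜ).Adj u v → u ∉ A → v ∉ A →
      s(a, b) ≠ s(u, v) → c s(a, b) = c s(u, v) → c s(a, b) ≠ 0 →
      (a ≠ u ∧ a ≠ v ∧ b ≠ u ∧ b ≠ v) ∧
      ¬G.Adj a u ∧ ¬G.Adj a v ∧ ¬G.Adj b u ∧ ¬G.Adj b v := by
    intro a b u v hab huv hu hv hne heq h0
    by_cases hin : a ∈ A ∧ b ∈ A
    · obtain ⟨ha, hb⟩ := hin
      refine ⟨⟨fun h => hu (h ▸ ha), fun h => hv (h ▸ ha), fun h => hu (h ▸ hb),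
        fun h => hv (h ▸ hb)⟩, mixed a b u v hab.1 huv.1 ha hb hu hv heq h0,
        mixed a b v u hab.1 huv.1.symm ha hb hv hu (by rwa [Sym2.eq_swap (a := v)]) h0,
        mixed b a u v hab.1.symm huv.1 hb ha hu hv (by rwa [Sym2.eq_swap (a := b)])
          (by rwa [Sym2.eq_swap (a := b)]),
        mixed b a v u hab.1.symm huv.1.symm hb ha hv hu
          (by rwa [Sym2.eq_swap (a := b), Sym2.eq_swap (a := v)])
          (by rwa [Sym2.eq_swap (a := b)])⟩
    · have hab' : (touching G Aᶜ).Adj a b := ⟨hab.1, by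
        rcases not_and_or.1 hin with h | h
        exacts [Or.inl h, Or.inr h]⟩
      obtain ⟨⟨d1, d2, d3, d4⟩, n1, n2, n3, n4⟩ :=
        inner₂ u v a b huv hab' hu hv hne.symm heq.symm (heq ▸ h0)
      exact ⟨⟨d1.symm, d3.symm, d2.symm, d4.symm⟩, fun h => n1 h.symm, fun h => n3 h.symm,
        fun h => n2 h.symm, fun h => n4 h.symm⟩
  have deg : ∀ a b, G.Adj a b → c s(a, b) = 0 →
      (G.neighborSet a).ncard = 3 ∧ (G.neighborSet b).ncard = 3 := by
    intro a b hab h0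
    rcases side a b hab with h | ⟨h, -, -⟩
    · rw [e₁ _ _ h] at h0
      exact (h₁.2 a b h h0).imp (ncard_neighborSet_eq_three_of_le hG (touching_le G A))
        (ncard_neighborSet_eq_three_of_le hG (touching_le G A))
    · rw [e₂ _ _ h] at h0
      exact (h₂.2 a b h h0).imp (ncard_neighborSet_eq_three_of_le hG (touching_le G Aᶜ))
        (ncard_neighborSet_eq_three_of_le hG (touching_le G Aᶜ))
  refine ⟨c, ⟨fun a b u v hab huv hne h1 h2 => ?_, fun a b u v hab huv hne heq h0 => ?_⟩, deg⟩
  · have both : ∀ a b u v, (touching G A).Adj a b → (touching G Aᶜ).Adj u v → u ∉ A → v ∉ A →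
        s(a, b) ≠ s(u, v) → c s(a, b) = 0 → c s(u, v) = 0 →
        a ≠ u ∧ a ≠ v ∧ b ≠ u ∧ b ≠ v := by
      intro a b u v hab huv hu hv hne h1 h2
      by_cases hin : a ∈ A ∧ b ∈ A
      · obtain ⟨ha, hb⟩ := hin
        exact ⟨fun h => hu (h ▸ ha), fun h => hv (h ▸ ha), fun h => hu (h ▸ hb),
          fun h => hv (h ▸ hb)⟩
      · have hab' : (touching G Aᶜ).Adj a b := ⟨hab.1, by
          rcases not_and_or.1 hin with h | h
          exacts [Or.inl h, Or.inr h]⟩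
        rw [e₂ _ _ hab'] at h1
        rw [e₂ _ _ huv] at h2
        exact h₂.1.1 a b u v hab' huv hne h1 h2
    rcases side a b hab with h | ⟨h, ha, hb⟩ <;> rcases side u v huv with h' | ⟨h', hu, hv⟩
    · exact h₁.1.1 a b u v h h' hne (e₁ _ _ h ▸ h1) (e₁ _ _ h' ▸ h2)
    · exact both a b u v h h' hu hv hne h1 h2
    · obtain ⟨d1, d2, d3, d4⟩ := both u v a b h' h ha hb hne.symm h2 h1
      exact ⟨d1.symm, d3.symm, d2.symm, d4.symm⟩
    · exact h₂.1.1 a b u v h h' hne (e₂ _ _ h ▸ h1) (e₂ _ _ h' ▸ h2)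
  · rcases side a b hab with h | ⟨h, ha, hb⟩ <;> rcases side u v huv with h' | ⟨h', hu, hv⟩
    · exact inner₁ a b u v h h' hne heq h0
    · exact outer a b u v h h' hu hv hne heq h0
    · obtain ⟨⟨d1, d2, d3, d4⟩, n1, n2, n3, n4⟩ :=
        outer u v a b h' h ha hb hne.symm heq.symm (heq ▸ h0)
      exact ⟨⟨d1.symm, d3.symm, d2.symm, d4.symm⟩, fun h => n1 h.symm, fun h => n3 h.symm,
        fun h => n2 h.symm, fun h => n4 h.symm⟩
    · exact inner₂ a b u v h h' ha hb hne heq h0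

/-- In a set of eight colors, two colors per side can be separated by a permutation fixing `0` and
prescribed at one further color. -/
lemma exists_perm_separating {X Y : Finset (Fin 8)} (hX : X.card ≤ 2) (hY : Y.card ≤ 2)
    {p q : Fin 8} (hp : p ≠ 0) (hq : q ≠ 0) :
    ∃ σ : Equiv.Perm (Fin 8), σ 0 = 0 ∧ σ p = q ∧
      ∀ i ∈ Y, i ≠ 0 → i ≠ p → σ i ∉ X := by
  classical
  let Y' := Y \ {0, p}
  let T := Finset.univ \ (X ∪ {0, q})
  have hY' : Y'.card ≤ 2 := (Finset.card_le_card Finset.sdiff_subset).trans hY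
  have hT : 4 ≤ T.card := by
    have h1 : (X ∪ {0, q}).card ≤ 4 :=
      (Finset.card_union_le _ _).trans (Nat.add_le_add hX Finset.card_le_two)
    have h2 := Finset.le_card_sdiff (X ∪ {0, q}) Finset.univ
    have h3 : (Finset.univ : Finset (Fin 8)).card = 8 := by simp
    change 4 ≤ (Finset.univ \ (X ∪ {0, q})).card
    omega
  obtain ⟨g⟩ : Nonempty (Y' ↪ T) :=
    Function.Embedding.nonempty_of_card_le (by simpa using hY'.trans (by omega))
  let f : Fin 8 → Fin 8 := fun i => if h : i ∈ Y' then g ⟨i, h⟩ else if i = 0 then 0 else q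
  have h0Y : (0 : Fin 8) ∉ Y' := by simp [Y']
  have hpY : p ∉ Y' := by simp [Y']
  have fY : ∀ i (h : i ∈ Y'), f i = g ⟨i, h⟩ := fun i h => by simp [f, h]
  have f0 : f 0 = 0 := by simp [f, h0Y]
  have fp : f p = q := by simp [f, hpY, hp]
  have gT : ∀ i, (g i : Fin 8) ∉ X ∧ (g i : Fin 8) ≠ 0 ∧ (g i : Fin 8) ≠ q := by
    intro i
    have := (g i).2
    simp only [T, Finset.mem_sdiff, Finset.mem_univ, true_and, Finset.mem_union,
      Finset.mem_insert, Finset.mem_singleton, not_or] at this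
    exact this
  have hinj : Set.InjOn f (insert 0 (insert p Y') : Finset (Fin 8)) := by
    intro i hi j hj hij
    simp only [Finset.coe_insert, Set.mem_insert_iff, Finset.mem_coe] at hi hj
    rcases hi with rfl | rfl | hi <;> rcases hj with rfl | rfl | hj
    · rfl
    · exact absurd (f0.symm.trans (hij.trans fp)).symm hq
    · exact absurd (f0.symm.trans (hij.trans (fY j hj))).symm (gT _).2.1
    · exact absurd (fp.symm.trans (hij.trans f0)) hq
    · rfl
    · exact absurd (fp.symm.trans (hij.trans (fY j hj))).symm (gT _).2.2
    · exact absurd ((fY i hi).symm.trans (hij.trans f0)) (gT _).2.1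
    · exact absurd ((fY i hi).symm.trans (hij.trans fp)) (gT _).2.2
    · rw [fY i hi, fY j hj] at hij
      exact congrArg Subtype.val (g.injective (Subtype.ext hij))
  obtain ⟨σ, hσ⟩ := Finset.exists_equiv_extend_of_card_eq (t := (Finset.univ : Finset (Fin 8)))
    (by simp) (Finset.subset_univ _) hinj
  refine ⟨σ.trans (Equiv.subtypeUnivEquiv Finset.mem_univ), ?_, ?_, fun i hi hi0 hip => ?_⟩
  · exact (hσ 0 (by simp)).trans f0
  · exact (hσ p (by simp)).trans fp
  · have hiY : i ∈ Y' := by simp [Y', hi, hi0, hip]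
    have : (σ i : Fin 8) = g ⟨i, hiY⟩ := (hσ i (by simp [hiY])).trans (fY i hiY)
    change (σ i : Fin 8) ∉ X
    rw [this]
    exact (gT _).1

/-- A good coloring of `G` without a pendant edge extends to `G`. -/
lemma exists_goodColoring_of_pendant {V : Type} [Finite V] {G : SimpleGraph V}
    (hG : Subcubic G) {x y : V} (hxy : G.Adj x y) (hx : ∀ a, G.Adj x a → a = y)
    {c : Sym2 V → Fin 8} (hc : GoodColoring (G.deleteEdges {s(x, y)}) c) :
    ∃ c : Sym2 V → Fin 8, GoodColoring G c := by
  classical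
  have := Fintype.ofFinite V
  let N : Finset V := (G.neighborSet y \ {x}).toFinset
  have hN : N.card ≤ 2 := by
    rw [← Set.ncard_eq_toFinset_card',
      Set.ncard_sdiff_singleton_of_mem (show x ∈ G.neighborSet y from hxy.symm)]
    have := hG y
    omega
  let S : Finset (Fin 8) :=
    N.biUnion fun w => (G.neighborSet w).toFinset.image fun z => c s(w, z)
  have hS : S.card ≤ 6 := by
    refine (Finset.card_biUnion_le_card_mul N _ 3 fun w _ => ?_).trans (by omega)
    refine Finset.card_image_le.trans ?_
    rw [← Set.ncard_eq_toFinset_card']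
    exact hG w
  obtain ⟨k, hk⟩ : ∃ k, k ∉ insert 0 S := by
    by_contra! h
    have h1 := Finset.card_insert_le 0 S
    rw [Finset.eq_univ_of_forall h] at h1
    simp at h1
    omega
  obtain ⟨hk0, hkS⟩ : k ≠ 0 ∧ k ∉ S := by simpa using hk
  have hkN : ∀ w z, G.Adj y w → w ≠ x → G.Adj w z → c s(w, z) ≠ k := by
    intro w z hw hwx hz h
    refine hkS (Finset.mem_biUnion.2 ⟨w, by simpa [N] using ⟨hw, hwx⟩, Finset.mem_image.2
      ⟨z, by simpa using hz, h⟩⟩)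
  have hH : ∀ a b, G.Adj a b → s(a, b) ≠ s(x, y) → (G.deleteEdges {s(x, y)}).Adj a b :=
    fun a b h hne => by simpa [deleteEdges_adj] using ⟨h, by simpa using hne⟩
  -- An edge other than `xy` avoids `x`, and if it has color `k` it is far from `y`.
  have far : ∀ u v, G.Adj u v → s(u, v) ≠ s(x, y) → u ≠ x := by
    rintro u v huv hne rfl
    exact hne (by rw [hx v huv])
  have far' : ∀ u v, G.Adj u v → s(u, v) ≠ s(x, y) → c s(u, v) = k →
      x ≠ u ∧ y ≠ u ∧ ¬G.Adj x u ∧ ¬G.Adj y u := by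
    intro u v huv hne hcu
    have hux := far u v huv hne
    have hvx := far v u huv.symm (by rwa [Sym2.eq_swap])
    have huy : y ≠ u := by
      rintro rfl
      exact hkN v y huv hvx huv.symm (by rwa [Sym2.eq_swap])
    exact ⟨hux.symm, huy, fun h => huy (hx u h).symm, fun h => hkN u v h hux huv hcu⟩
  let c' := Function.update c s(x, y) k
  have hc'e : c' s(x, y) = k := Function.update_self ..
  have hc' : ∀ e, e ≠ s(x, y) → c' e = c e := fun e he => Function.update_of_ne he ..
  have pend : ∀ a b u v, s(a, b) = s(x, y) → G.Adj u v → s(u, v) ≠ s(x, y) → c s(u, v) = k →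
      (a ≠ u ∧ a ≠ v ∧ b ≠ u ∧ b ≠ v) ∧
      ¬G.Adj a u ∧ ¬G.Adj a v ∧ ¬G.Adj b u ∧ ¬G.Adj b v := by
    intro a b u v hab huv hne hcu
    obtain ⟨a1, a2, a3, a4⟩ := far' u v huv hne hcu
    obtain ⟨b1, b2, b3, b4⟩ := far' v u huv.symm (by rwa [Sym2.eq_swap]) (by rwa [Sym2.eq_swap])
    rcases Sym2.eq_iff.1 hab with ⟨rfl, rfl⟩ | ⟨rfl, rfl⟩
    · exact ⟨⟨a1, b1, a2, b2⟩, a3, b3, a4, b4⟩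
    · exact ⟨⟨a2, b2, a1, b1⟩, a4, b4, a3, b3⟩
  have lift : ∀ a b u v, G.Adj a b → G.Adj u v → s(a, b) ≠ s(x, y) → s(u, v) ≠ s(x, y) →
      ¬(G.deleteEdges {s(x, y)}).Adj a u → ¬G.Adj a u := by
    intro a b u v hab huv h1 h2 hn hau
    refine hn (hH a u hau fun h => ?_)
    rcases Sym2.eq_iff.1 h with ⟨h, -⟩ | ⟨-, h⟩
    exacts [far a b hab h1 h, far u v huv h2 h]
  refine ⟨c', ⟨fun a b u v hab huv hne h1 h2 => ?_, fun a b u v hab huv hne heq h0 => ?_⟩,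
    fun a b hab h0 => ?_⟩
  · have ha : s(a, b) ≠ s(x, y) := fun h => hk0 (by rw [← hc'e, ← h, h1])
    have hu : s(u, v) ≠ s(x, y) := fun h => hk0 (by rw [← hc'e, ← h, h2])
    exact hc.1.1 a b u v (hH a b hab ha) (hH u v huv hu) hne (hc' _ ha ▸ h1) (hc' _ hu ▸ h2)
  · by_cases ha : s(a, b) = s(x, y)
    · have hu : s(u, v) ≠ s(x, y) := fun h => hne (ha.trans h.symm)
      rw [ha, hc'e, hc' _ hu] at heq
      exact pend a b u v ha huv hu heq.symm
    · by_cases hu : s(u, v) = s(x, y)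
      · rw [hu, hc'e, hc' _ ha] at heq
        obtain ⟨⟨d1, d2, d3, d4⟩, n1, n2, n3, n4⟩ := pend u v a b hu hab ha heq
        exact ⟨⟨d1.symm, d3.symm, d2.symm, d4.symm⟩, fun h => n1 h.symm, fun h => n3 h.symm,
          fun h => n2 h.symm, fun h => n4 h.symm⟩
      · rw [hc' _ ha] at heq h0
        rw [hc' _ hu] at heq
        obtain ⟨hd, n1, n2, n3, n4⟩ :=
          hc.1.2 a b u v (hH a b hab ha) (hH u v huv hu) hne heq h0
        have hba : s(b, a) ≠ s(x, y) := by rwa [Sym2.eq_swap]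
        have hvu : s(v, u) ≠ s(x, y) := by rwa [Sym2.eq_swap]
        exact ⟨hd, lift a b u v hab huv ha hu n1, lift a b v u hab huv.symm ha hvu n2,
          lift b a u v hab.symm huv hba hu n3, lift b a v u hab.symm huv.symm hba hvu n4⟩
  · have ha : s(a, b) ≠ s(x, y) := fun h => hk0 (by rw [← hc'e, ← h, h0])
    exact (hc.2 a b (hH a b hab ha) (hc' _ ha ▸ h0)).imp
      (ncard_neighborSet_eq_three_of_le hG (deleteEdges_le _))
      (ncard_neighborSet_eq_three_of_le hG (deleteEdges_le _))

lemma MinCounter.exists_goodColoring_of_lt {V : Type} [Finite V] {G H : SimpleGraph V}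
    (hG : MinCounter V G) (h : H < G) : ∃ c : Sym2 V → Fin 8, GoodColoring H c :=
  hG.2.2 V H (hG.1.mono h.le) (Nat.add_lt_add_left
    (Set.ncard_lt_ncard (edgeSet_strict_mono h) (Set.toFinite _)) _)

/-- In a minimal counterexample, a union of components other than the whole vertex set has a good
coloring. -/
lemma MinCounter.exists_goodColoring_touching {V : Type} [Finite V] {G : SimpleGraph V}
    (hG : MinCounter V G) {A : Set V} {x y : V} (hx : x ∈ A) (hy : y ∉ A)
    (hcut : ∀ a b, a ∈ A → b ∉ A → ¬G.Adj a b) :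
    ∃ c : Sym2 V → Fin 8, GoodColoring (touching G A) c := by
  classical
  have hnb : ∀ a : A, ((G.induce A).neighborSet a).ncard = (G.neighborSet a).ncard := by
    intro a
    rw [← Set.ncard_image_of_injective _ Subtype.val_injective]
    congr 1
    ext b
    constructor
    · rintro ⟨b, hb, rfl⟩
      exact hb
    · intro hb
      exact ⟨⟨b, by_contra fun h => hcut a b a.2 h hb⟩, hb, rfl⟩
  have hnb' : ∀ a : A, (touching G A).neighborSet a = G.neighborSet a := by
    intro a
    ext b
    exact ⟨fun h => h.1, fun h => ⟨h, Or.inl a.2⟩⟩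
  have hedge : (G.induce A).edgeSet.ncard ≤ G.edgeSet.ncard := by
    rw [← Set.ncard_image_of_injective _ (Sym2.map.injective Subtype.val_injective)]
    refine Set.ncard_le_ncard ?_ (Set.toFinite _)
    rintro _ ⟨e, he, rfl⟩
    induction e with
    | h a b => exact he
  have hcard : Nat.card A < Nat.card V := by
    rw [Nat.card_coe_set_eq]
    exact Set.ncard_lt_card fun h => hy (h ▸ Set.mem_univ y)
  obtain ⟨c, hc⟩ := hG.2.2 A (G.induce A) (fun a => hnb a ▸ hG.1 a)
    (Nat.add_lt_add_of_lt_of_le hcard hedge)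
  let r : V → A := fun v => if h : v ∈ A then ⟨v, h⟩ else ⟨x, hx⟩
  have hr : ∀ a : A, r a = a := fun a => by simp [r]
  have hmem : ∀ a b, (touching G A).Adj a b → ∃ a' b' : A, a = a' ∧ b = b' ∧ G.Adj a' b' := by
    intro a b h
    rcases h.2 with ha | hb
    · exact ⟨⟨a, ha⟩, ⟨b, by_contra fun hb => hcut a b ha hb h.1⟩, rfl, rfl, h.1⟩
    · exact ⟨⟨a, by_contra fun ha => hcut b a hb ha h.1.symm⟩, ⟨b, hb⟩, rfl, rfl, h.1⟩
  have hne : ∀ a b u v : A, s((a : V), (b : V)) ≠ s((u : V), (v : V)) → s(a, b) ≠ s(u, v) :=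
    fun a b u v h h' => h (congrArg (Sym2.map Subtype.val) h')
  refine ⟨c ∘ Sym2.map r, ⟨fun a b u v hab huv hd h1 h2 => ?_,
    fun a b u v hab huv hd heq h0 => ?_⟩, fun a b hab h0 => ?_⟩
  · obtain ⟨a, b, rfl, rfl, hab₁⟩ := hmem a b hab
    obtain ⟨u, v, rfl, rfl, huv'⟩ := hmem u v huv
    simp only [Function.comp_apply, Sym2.map_mk, hr] at h1 h2
    simpa [Subtype.ext_iff] using hc.1.1 a b u v hab₁ huv' (hne _ _ _ _ hd) h1 h2
  · obtain ⟨a, b, rfl, rfl, hab₁⟩ := hmem a b hab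
    obtain ⟨u, v, rfl, rfl, huv'⟩ := hmem u v huv
    simp only [Function.comp_apply, Sym2.map_mk, hr] at heq h0
    have := hc.1.2 a b u v hab₁ huv' (hne _ _ _ _ hd) heq h0
    simpa [Subtype.ext_iff, touching] using this
  · obtain ⟨a, b, rfl, rfl, hab₁⟩ := hmem a b hab
    simp only [Function.comp_apply, Sym2.map_mk, hr] at h0
    rw [hnb', hnb', ← hnb, ← hnb]
    exact hc.2 a b hab₁ h0

/-- The set of colors on the edges at a vertex of a subcubic graph, apart from one given edge, has
at most two elements. -/
lemma Subcubic.exists_finset_colors {V : Type} [Finite V] {G : SimpleGraph V} (hG : Subcubic G)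
    {x y : V} (hxy : G.Adj x y) (c : Sym2 V → Fin 8) :
    ∃ X : Finset (Fin 8), X.card ≤ 2 ∧ ∀ a, G.Adj x a → a ≠ y → c s(x, a) ∈ X := by
  classical
  have := Fintype.ofFinite V
  refine ⟨(G.neighborSet x \ {y}).toFinset.image fun a => c s(x, a), ?_, fun a ha hay => ?_⟩
  · refine Finset.card_image_le.trans ?_
    rw [← Set.ncard_eq_toFinset_card',
      Set.ncard_sdiff_singleton_of_mem (show y ∈ G.neighborSet x from hxy)]
    have := hG x
    omega
  · exact Finset.mem_image.2 ⟨a, by simpa using ⟨ha, hay⟩, rfl⟩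

/-- On the side `A` of a cut whose only edge is `xy`, the edge `xy` is pendant and so does not
get color `0`. -/
lemma GoodColoring.touching_ne_zero {V : Type} [Finite V] {G : SimpleGraph V} {A : Set V}
    {x y : V} (hx : x ∈ A) (hy : y ∉ A)
    (hcut : ∀ a b, a ∈ A → b ∉ A → G.Adj a b → a = x ∧ b = y) (hxy : G.Adj x y)
    {c : Sym2 V → Fin 8} (hc : GoodColoring (touching G A) c) : c s(x, y) ≠ 0 := by
  intro h0
  have h3 := (hc.2 x y ⟨hxy, Or.inl hx⟩ h0).2
  have hsub : (touching G A).neighborSet y ⊆ {x} :=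
    fun a ha => (hcut a y (ha.2.resolve_left hy) hy ha.1.symm).1
  have := Set.ncard_le_ncard hsub
  rw [h3, Set.ncard_singleton] at this
  omega

lemma touching_lt {V : Type} {G : SimpleGraph V} {A : Set V} {x y b : V} (hy : y ∉ A)
    (hcut : ∀ a b, a ∈ A → b ∉ A → G.Adj a b → a = x ∧ b = y) (hyb : G.Adj y b) (hbx : b ≠ x) :
    touching G A < G := by
  refine lt_of_le_not_ge (touching_le G A) fun h => ?_
  exact hbx (hcut b y ((h hyb).2.resolve_left hy) hy hyb.symm).1


/-- A minimal counterexample has no cut-edge (bridge). -/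
theorem minCounter_no_bridge {V : Type} [Finite V] (G : SimpleGraph V)
    (hG : MinCounter V G) :
    ∀ e : Sym2 V, ¬G.IsBridge e := by
  intro e he
  induction e with
  | h x y =>
  rw [isBridge_iff] at he
  let A : Set V := {w | (G.deleteEdges {s(x, y)}).Reachable x w}
  have hx : x ∈ A := Reachable.refl x
  have hy : y ∉ A := he
  have hcut : ∀ a b, a ∈ A → b ∉ A → G.Adj a b → a = x ∧ b = y := by
    intro a b ha hb hab
    by_cases h : s(a, b) = s(x, y)
    · rcases Sym2.eq_iff.1 h with h | ⟨rfl, -⟩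
      exacts [h, absurd ha hy]
    · have hab' : (G.deleteEdges {s(x, y)}).Adj a b := by
        rw [deleteEdges_adj]
        exact ⟨hab, h⟩
      exact absurd (Reachable.trans ha hab'.reachable) hb
  have hcut' : ∀ a b, a ∈ Aᶜ → b ∉ Aᶜ → G.Adj a b → a = y ∧ b = x :=
    fun a b ha hb hab => (hcut b a (not_not.1 hb) ha hab.symm).symm
  by_cases hxy : G.Adj x y
  · have hdel : G.deleteEdges {s(x, y)} < G := by
      refine lt_of_le_not_ge (deleteEdges_le _) fun h => ?_
      have := h hxy
      simp [deleteEdges_adj] at this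
    obtain ⟨c, hc⟩ := hG.exists_goodColoring_of_lt hdel
    by_cases hpx : ∀ a, G.Adj x a → a = y
    · exact hG.2.1 (exists_goodColoring_of_pendant hG.1 hxy hpx hc)
    by_cases hpy : ∀ b, G.Adj y b → b = x
    · rw [Sym2.eq_swap] at hc
      exact hG.2.1 (exists_goodColoring_of_pendant hG.1 hxy.symm hpy hc)
    push Not at hpx hpy
    obtain ⟨a, hxa, hay⟩ := hpx
    obtain ⟨b, hyb, hbx⟩ := hpy
    obtain ⟨c₁, h₁⟩ := hG.exists_goodColoring_of_lt (touching_lt hy hcut hyb hbx)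
    obtain ⟨c₂, h₂⟩ := hG.exists_goodColoring_of_lt (touching_lt (not_not.2 hx) hcut' hxa hay)
    obtain ⟨X, hX, hXc⟩ := hG.1.exists_finset_colors hxy c₁
    obtain ⟨Y, hY, hYc⟩ := hG.1.exists_finset_colors hxy.symm c₂
    have hq : c₁ s(x, y) ≠ 0 := h₁.touching_ne_zero hx hy hcut hxy
    have hp : c₂ s(y, x) ≠ 0 := h₂.touching_ne_zero hy (not_not.2 hx) hcut' hxy.symm
    obtain ⟨σ, σ0, σp, hσ⟩ := exists_perm_separating hX hY hp hq
    refine hG.2.1 (exists_goodColoring_of_touching hG.1 hx hy hcut h₁ (h₂.perm_comp σ σ0)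
      fun _ => ⟨?_, fun a b hxa hyb hay hbx heq => ?_⟩)
    · rw [Function.comp_apply, Sym2.eq_swap (a := x), σp, Sym2.eq_swap]
    · by_contra hne
      simp only [Function.comp_apply] at heq
      refine hσ (c₂ s(y, b)) (hYc b hyb hbx) (fun h => hne ?_) (fun h => ?_)
        (heq ▸ hXc a hxa hay)
      · rw [heq, h, σ0]
      · refine (h₂.1.2 y b y x ⟨hyb, Or.inl hy⟩ ⟨hxy.symm, Or.inl hy⟩ ?_ h (h ▸ hp)).1.1 rfl
        exact fun h' => hbx (Sym2.congr_right.1 h')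
  · obtain ⟨c₁, h₁⟩ := hG.exists_goodColoring_touching hx hy fun a b ha hb hab =>
      hxy (by obtain ⟨rfl, rfl⟩ := hcut a b ha hb hab; exact hab)
    obtain ⟨c₂, h₂⟩ := hG.exists_goodColoring_touching (A := Aᶜ) hy (not_not.2 hx)
      fun a b ha hb hab => hxy (by obtain ⟨rfl, rfl⟩ := hcut' a b ha hb hab; exact hab.symm)
    exact hG.2.1 (exists_goodColoring_of_touching hG.1 hx hy hcut h₁ h₂ fun h => absurd h hxy)
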